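/- Let d ≥ 6. Then B (log B)^{C(d,2) − 1} ≪ N_d(B), and for every ε > 0, N_d(B) ≪_ε B^{d/2 − 7/6 + ε} as B → ∞, where C(d,2) = d(d−1)/2. That is, there is c > 0 with N_d(B) ≥ c · B (log B)^{d(d−1)/2 − 1} for all large B, and for each ε > 0 there is C(ε) > 0 with N_d(B) ≤ C(ε) · B^{d/2 − 7/6 + ε} for all large B. -/

import Mathlib

/-- `N_d(B)`: the number of orders of `ℤ^d` (unital subrings of the ring `Fin d → ℤ`
with componentwise operations, of finite additive index) whose additive index is at
most `B`. -/
noncomputable def numOrdersZ (d : ℕ) (B : ℝ) : ℕ :=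
  Nat.card {O : Subring (Fin d → ℤ) //
    O.toAddSubgroup.index ≠ 0 ∧ (O.toAddSubgroup.index : ℝ) ≤ B}

/-- Padding a vector by a zero in front, as a non-unital ring homomorphism. -/
def consZeroHom (r : ℕ) : (Fin r → ℤ) →ₙ+* (Fin (r + 1) → ℤ) where
  toFun v := Fin.cons 0 v
  map_mul' v w := by
    ext i; refine Fin.cases ?_ (fun i => ?_) i <;> simp
  map_zero' := by
    ext i; refine Fin.cases ?_ (fun i => ?_) i <;> simp
  map_add' v w := by
    ext i; refine Fin.cases ?_ (fun i => ?_) i <;> simp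

/-- The inclusion of the elements of `L` whose first coordinate vanishes. -/
def consZeroIncl {r : ℕ} (L : NonUnitalSubring (Fin (r + 1) → ℤ)) :
    L.comap (consZeroHom r) →ₙ+* L where
  toFun v := ⟨consZeroHom r v, v.2⟩
  map_mul' _ _ := Subtype.ext (map_mul (consZeroHom r) _ _)
  map_zero' := Subtype.ext (map_zero (consZeroHom r))
  map_add' _ _ := Subtype.ext (map_add (consZeroHom r) _ _)

lemma exists_consZeroIncl_eq {r : ℕ} {L : NonUnitalSubring (Fin (r + 1) → ℤ)} (y : L)
    (hy : (y : Fin (r + 1) → ℤ) 0 = 0) : ∃ z, consZeroIncl L z = y := by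
  have h : consZeroHom r (Fin.tail (y : Fin (r + 1) → ℤ)) = y := by
    ext i
    refine Fin.cases ?_ (fun i => ?_) i
    · exact hy.symm
    · rfl
  exact ⟨⟨Fin.tail (y : Fin (r + 1) → ℤ), by
    rw [NonUnitalSubring.mem_comap, h]; exact y.2⟩, Subtype.ext h⟩

/-- If the value of a homomorphism at `x` takes at most `N` values once its value at
`x * x - c • x` is known, then there are at most `N ^ r` homomorphisms. -/
lemma card_nonUnitalRingHom_le {R : Type*} [CommRing R] [DecidableEq R] (N : ℕ) :
    ∀ (r : ℕ) (L : NonUnitalSubring (Fin r → ℤ)) (Φ : Finset (L →ₙ+* R)),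
      (∀ (x : L) (c : ℤ) (y : R),
        ((Φ.filter fun φ => φ (x * x - c • x) = y).image fun φ => φ x).card ≤ N) →
      Φ.card ≤ N ^ r
  | 0, L, Φ, _ => by
    rw [pow_zero, Finset.card_le_one]
    intro φ _ ψ _
    ext x
    have : x = 0 := Subtype.ext (Subsingleton.elim _ _)
    rw [this, map_zero, map_zero]
  | r + 1, L, Φ, hN => by
    classical
    obtain ⟨c, hc⟩ := Int.subgroup_cyclic
      (L.toAddSubgroup.map (Pi.evalAddMonoidHom (fun _ : Fin (r + 1) => ℤ) 0))
    have hmem : ∀ y : L, ∃ n : ℤ, (y : Fin (r + 1) → ℤ) 0 = n * c := by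
      intro y
      have h : (y : Fin (r + 1) → ℤ) 0 ∈
          L.toAddSubgroup.map (Pi.evalAddMonoidHom (fun _ : Fin (r + 1) => ℤ) 0) :=
        ⟨y, y.2, rfl⟩
      rw [hc, AddSubgroup.mem_closure_singleton] at h
      obtain ⟨n, hn⟩ := h
      exact ⟨n, by simpa using hn.symm⟩
    obtain ⟨x, hx⟩ : ∃ x : L, (x : Fin (r + 1) → ℤ) 0 = c := by
      have h : c ∈ L.toAddSubgroup.map (Pi.evalAddMonoidHom (fun _ : Fin (r + 1) => ℤ) 0) := by
        rw [hc]; exact AddSubgroup.mem_closure_singleton_self c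
      obtain ⟨x, hx, hxc⟩ := h
      exact ⟨⟨x, hx⟩, hxc⟩
    obtain ⟨z, hz⟩ : ∃ z, consZeroIncl L z = x * x - c • x :=
      exists_consZeroIncl_eq _ (by simp [hx])
    have hdet : ∀ φ ψ : L →ₙ+* R, φ.comp (consZeroIncl L) = ψ.comp (consZeroIncl L) →
        φ x = ψ x → φ = ψ := by
      intro φ ψ h hxx
      ext y
      obtain ⟨n, hn⟩ := hmem y
      obtain ⟨u, hu⟩ := exists_consZeroIncl_eq (y - n • x) (by simp [hx, hn])
      have h1 : φ (y - n • x) = ψ (y - n • x) := by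
        rw [← hu]; exact DFunLike.congr_fun h u
      rw [map_sub, map_sub, map_zsmul, map_zsmul, hxx] at h1
      exact sub_left_injective h1
    refine (Finset.card_le_mul_card_image (f := fun φ => φ.comp (consZeroIncl L)) Φ N ?_).trans ?_
    · intro ψ _
      refine le_trans ?_ (hN x c (ψ z))
      rw [← Finset.card_image_of_injOn (f := fun φ : L →ₙ+* R => φ x)
        (s := Φ.filter fun φ => φ.comp (consZeroIncl L) = ψ)]
      · refine Finset.card_le_card (Finset.image_subset_image ?_)
        intro φ hφ
        rw [Finset.mem_filter] at hφ ⊢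
        refine ⟨hφ.1, ?_⟩
        rw [← hφ.2, ← hz]; rfl
      · intro φ hφ φ' hφ' h
        simp only [Finset.coe_filter, Set.mem_ofPred_eq] at hφ hφ'
        exact hdet _ _ (hφ.2.trans hφ'.2.symm) h
    · rw [pow_succ, mul_comm]
      refine Nat.mul_le_mul_right _ (card_nonUnitalRingHom_le N r _ _ ?_)
      intro x' c' y
      refine le_trans (Finset.card_le_card ?_) (hN (consZeroIncl L x') c' y)
      intro t ht
      simp only [Finset.mem_image, Finset.mem_filter] at ht ⊢
      obtain ⟨_, ⟨⟨φ, hφ, rfl⟩, h1⟩, rfl⟩ := ht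
      refine ⟨φ, ⟨hφ, ?_⟩, rfl⟩
      rw [← h1, ← map_zsmul, ← map_mul, ← map_sub]; rfl

/-- The unital version of `card_nonUnitalRingHom_le`. -/
lemma card_ringHom_le {R : Type*} [CommRing R] [DecidableEq R] (N k : ℕ)
    (O : Subring (Fin (k + 1) → ℤ)) (Φ : Finset (O →+* R))
    (hN : ∀ (x : O) (c : ℤ) (y : R),
      ((Φ.filter fun φ => φ (x * x - c • x) = y).image fun φ => φ x).card ≤ N) :
    Φ.card ≤ N ^ k := by
  classical
  let L := O.toNonUnitalSubring
  let incl : L.comap (consZeroHom k) →ₙ+* O := consZeroIncl L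
  have hincl : ∀ y : O, (y : Fin (k + 1) → ℤ) 0 = 0 → ∃ z, incl z = y := fun y hy =>
    exists_consZeroIncl_eq (L := L) y hy
  have hinj : Set.InjOn (fun φ : O →+* R => (φ : O →ₙ+* R).comp incl) (Φ : Set (O →+* R)) := by
    intro φ _ ψ _ h
    ext y
    obtain ⟨u, hu⟩ := hincl (y - ((y : Fin (k + 1) → ℤ) 0 : ℤ)) (by simp)
    have h1 : φ (y - ((y : Fin (k + 1) → ℤ) 0 : ℤ)) = ψ (y - ((y : Fin (k + 1) → ℤ) 0 : ℤ)) := by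
      rw [← hu]; exact DFunLike.congr_fun h u
    rw [map_sub, map_sub, map_intCast, map_intCast] at h1
    exact sub_left_injective h1
  rw [← Finset.card_image_of_injOn hinj]
  refine card_nonUnitalRingHom_le N k _ _ ?_
  intro x' c' y
  refine le_trans (Finset.card_le_card ?_) (hN (incl x') c' y)
  intro t ht
  simp only [Finset.mem_image, Finset.mem_filter] at ht ⊢
  obtain ⟨_, ⟨⟨φ, hφ, rfl⟩, h1⟩, rfl⟩ := ht
  refine ⟨φ, ⟨hφ, ?_⟩, rfl⟩
  rw [← h1, ← map_zsmul, ← map_mul, ← map_sub]; rfl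

lemma card_nsmul_sub_eq_zero_le {n : ℕ} [NeZero n] {a : ℕ} (ha : 0 < a) (t₀ : ZMod n) :
    (Finset.univ.filter fun t : ZMod n => a • (t - t₀) = 0).card ≤ a := by
  refine le_trans ?_ (IsAddCyclic.card_nsmul_eq_zero_le (α := ZMod n) ha)
  refine Finset.card_le_card_of_injOn (fun t => t - t₀) ?_ (sub_left_injective.injOn)
  intro t ht
  simpa using ht

lemma nsmul_eq_zero_or_of_mul_eq_zero {p : ℕ} (hp : p.Prime) {j : ℕ} {a b : ZMod (p ^ j)}
    (h : a * b = 0) : (p ^ (j / 2)) • a = 0 ∨ (p ^ (j / 2)) • b = 0 := by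
  have : NeZero (p ^ j) := ⟨pow_ne_zero _ hp.ne_zero⟩
  obtain ⟨x, rfl⟩ := ZMod.natCast_zmod_surjective a
  obtain ⟨y, rfl⟩ := ZMod.natCast_zmod_surjective b
  rw [← Nat.cast_mul, ZMod.natCast_eq_zero_iff] at h
  simp only [nsmul_eq_mul, ← Nat.cast_mul, ZMod.natCast_eq_zero_iff]
  rcases eq_or_ne x 0 with rfl | hx
  · left; simp
  obtain ⟨e, u, hu, rfl⟩ := Nat.exists_eq_pow_mul_and_not_dvd hx p hp.ne_one
  have hcop : Nat.Coprime (p ^ j) u := Nat.Coprime.pow_left _ ((hp.coprime_iff_not_dvd).2 hu)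
  rcases le_or_gt j (j / 2 + e) with he | he
  · left
    rw [← mul_assoc, ← pow_add]
    exact (pow_dvd_pow p he).mul_right u
  · right
    have h1 : p ^ j ∣ p ^ e * y := by
      refine hcop.dvd_of_dvd_mul_left ?_
      convert h using 1; ring
    exact h1.trans (Nat.mul_dvd_mul_right (pow_dvd_pow p (by omega)) y)

lemma card_sq_sub_mul_eq_le {p : ℕ} (hp : p.Prime) (j : ℕ) [NeZero (p ^ j)]
    (c y : ZMod (p ^ j)) :
    (Finset.univ.filter fun t : ZMod (p ^ j) => t * t - c * t = y).card ≤ 2 * p ^ (j / 2) := by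
  rcases Finset.eq_empty_or_nonempty
    (Finset.univ.filter fun t : ZMod (p ^ j) => t * t - c * t = y) with h | ⟨t₀, ht₀⟩
  · rw [h]; simp
  · rw [Finset.mem_filter] at ht₀
    have hpos : 0 < p ^ (j / 2) := pow_pos hp.pos _
    calc _ ≤ ((Finset.univ.filter fun t : ZMod (p ^ j) => (p ^ (j / 2)) • (t - t₀) = 0) ∪
          (Finset.univ.filter fun t : ZMod (p ^ j) => (p ^ (j / 2)) • (t - (c - t₀)) = 0)).card := by
          refine Finset.card_le_card fun t ht => ?_
          simp only [Finset.mem_filter, Finset.mem_univ, true_and, Finset.mem_union] at ht ⊢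
          refine nsmul_eq_zero_or_of_mul_eq_zero hp ?_
          linear_combination ht - ht₀.2
      _ ≤ _ := (Finset.card_union_le _ _).trans (by
          have h1 := card_nsmul_sub_eq_zero_le hpos t₀
          have h2 := card_nsmul_sub_eq_zero_le hpos (c - t₀)
          omega)

lemma card_ringHom_le_sqrt {p : ℕ} (hp : p.Prime) (j k : ℕ) (O : Subring (Fin (k + 1) → ℤ))
    (Φ : Finset (O →+* ZMod (p ^ j))) : Φ.card ≤ (2 * p ^ (j / 2)) ^ k := by
  have : NeZero (p ^ j) := ⟨pow_ne_zero _ hp.ne_zero⟩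
  refine card_ringHom_le _ k O Φ fun x c y => ?_
  refine le_trans (Finset.card_le_card ?_) (card_sq_sub_mul_eq_le hp j (c : ZMod (p ^ j)) y)
  intro t ht
  simp only [Finset.mem_image, Finset.mem_filter, Finset.mem_univ, true_and] at ht ⊢
  obtain ⟨φ, ⟨_, h1⟩, rfl⟩ := ht
  rw [← h1, map_sub, map_mul, map_zsmul, zsmul_eq_mul]

/-- Every homomorphism from an order to `ℤ / p ^ j` is close to a coordinate projection. -/
lemma exists_nsmul_sub_eq_zero {p : ℕ} (hp : p.Prime) (j k : ℕ) (O : Subring (Fin (k + 1) → ℤ))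
    (hO : O.toAddSubgroup.index ≠ 0) (φ : O →+* ZMod (p ^ j)) :
    ∃ i : Fin (k + 1), ∀ x : O,
      (p ^ (O.toAddSubgroup.index.factorization p)) •
        (φ x - ((x : Fin (k + 1) → ℤ) i : ZMod (p ^ j))) = 0 := by
  have : NeZero (p ^ j) := ⟨pow_ne_zero _ hp.ne_zero⟩
  set M := O.toAddSubgroup.index with hM
  set v := M.factorization p with hv
  rcases le_or_gt j v with hjv | hjv
  · refine ⟨0, fun x => ?_⟩
    rw [nsmul_eq_mul, (ZMod.natCast_eq_zero_iff _ _).2 (pow_dvd_pow p hjv), zero_mul]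
  have hmem : ∀ i : Fin (k + 1), (Pi.single i (M : ℤ) : Fin (k + 1) → ℤ) ∈ O := by
    intro i
    have h := AddSubgroup.nsmul_index_mem (H := O.toAddSubgroup) (Pi.single i (1 : ℤ))
    rw [← hM, ← Pi.single_smul] at h
    simpa using h
  let e : Fin (k + 1) → O := fun i => ⟨Pi.single i (M : ℤ), hmem i⟩
  have hsum : ∑ i, φ (e i) = M := by
    rw [← map_sum, ← map_natCast φ]
    congr 1
    ext i
    simp [e, Finset.sum_apply, Pi.single_apply]
  have hmul : ∀ i (x : O), φ (e i) * (φ x - ((x : Fin (k + 1) → ℤ) i : ZMod (p ^ j))) = 0 := by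
    intro i x
    rw [← map_intCast φ, ← map_sub, ← map_mul, ← map_zero φ]
    congr 1
    ext l
    rcases eq_or_ne l i with rfl | h
    · simp [e]
    · simp [e, h]
  have hMv : ¬ p ^ (v + 1) ∣ M := Nat.pow_succ_factorization_not_dvd hO hp
  obtain ⟨i, hi⟩ : ∃ i, ¬ p ^ (v + 1) ∣ (φ (e i)).val := by
    by_contra! hcon
    apply hMv
    have h1 : ((∑ i, (φ (e i)).val : ℕ) : ZMod (p ^ j)) = (M : ℕ) := by
      rw [← hsum]; push_cast; simp
    rw [ZMod.natCast_eq_natCast_iff] at h1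
    have h2 := h1.of_dvd (pow_dvd_pow p hjv)
    exact (Nat.modEq_zero_iff_dvd).1
      (h2.symm.trans ((Nat.modEq_zero_iff_dvd).2 (Finset.dvd_sum fun i _ => hcon i)))
  refine ⟨i, fun x => ?_⟩
  have hx := hmul i x
  set t := (φ (e i)).val with ht
  have ht0 : t ≠ 0 := by rintro h; rw [h] at hi; simp at hi
  obtain ⟨a, u, hu, htu⟩ := Nat.exists_eq_pow_mul_and_not_dvd ht0 p hp.ne_one
  have hav : a ≤ v := by
    by_contra! h
    exact hi (htu ▸ (pow_dvd_pow p h).mul_right u)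
  have hunit : IsUnit (u : ZMod (p ^ j)) := by
    rw [ZMod.isUnit_iff_coprime]
    exact Nat.Coprime.symm (Nat.Coprime.pow_left _ ((hp.coprime_iff_not_dvd).2 hu))
  have hφ : φ (e i) = (p : ZMod (p ^ j)) ^ a * u := by
    rw [← ZMod.natCast_zmod_val (φ (e i)), ← ht, htu]; push_cast; rfl
  rw [hφ, mul_comm _ (u : ZMod (p ^ j)), mul_assoc, hunit.mul_right_eq_zero] at hx
  rw [nsmul_eq_mul, ← Nat.add_sub_of_le hav, pow_add, mul_comm (p ^ a)]
  push_cast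
  rw [mul_assoc, hx, mul_zero]

lemma card_ringHom_le_index {p : ℕ} (hp : p.Prime) (j k : ℕ) (O : Subring (Fin (k + 1) → ℤ))
    (hO : O.toAddSubgroup.index ≠ 0) (Φ : Finset (O →+* ZMod (p ^ j))) :
    Φ.card ≤ (k + 1) * (p ^ (O.toAddSubgroup.index.factorization p)) ^ k := by
  classical
  have : NeZero (p ^ j) := ⟨pow_ne_zero _ hp.ne_zero⟩
  choose i hi using exists_nsmul_sub_eq_zero hp j k O hO
  have h := Finset.card_le_mul_card_image (f := i) Φ
    ((p ^ (O.toAddSubgroup.index.factorization p)) ^ k) (fun b _ => by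
      refine card_ringHom_le _ k O _ fun x c y => ?_
      refine le_trans (Finset.card_le_card ?_) (card_nsmul_sub_eq_zero_le
        (pow_pos hp.pos (O.toAddSubgroup.index.factorization p))
        ((x : Fin (k + 1) → ℤ) b : ZMod (p ^ j)))
      intro t ht
      simp only [Finset.mem_image, Finset.mem_filter, Finset.mem_univ, true_and] at ht ⊢
      obtain ⟨φ, ⟨⟨_, h0⟩, _⟩, rfl⟩ := ht
      rw [← h0]; exact hi φ x)
  refine h.trans ?_
  rw [mul_comm]
  refine Nat.mul_le_mul_right _ ((Finset.card_le_univ _).trans (by simp))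

lemma finite_and_card_le_of_finset {α : Type*} {n : ℕ} (h : ∀ s : Finset α, s.card ≤ n) :
    Finite α ∧ Nat.card α ≤ n := by
  have hfin : Finite α := by
    by_contra hinf
    rw [not_finite_iff_infinite] at hinf
    obtain ⟨s, hs⟩ := Infinite.exists_subset_card_eq α (n + 1)
    have := h s
    omega
  have := Fintype.ofFinite α
  exact ⟨hfin, by rw [Nat.card_eq_fintype_card]; exact h Finset.univ⟩

/-- The interpolated bound for the number of homomorphisms to `ℤ / p ^ j`. -/
lemma card_ringHom_primePow_le {p : ℕ} (hp : p.Prime) (j k : ℕ)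
    (O : Subring (Fin (k + 1) → ℤ)) (hO : O.toAddSubgroup.index ≠ 0) {w : ℝ}
    (hw0 : 0 ≤ w) (hw1 : w ≤ 1) :
    (Nat.card (O →+* ZMod (p ^ j)) : ℝ) ≤ 2 ^ k *
      ((p : ℝ) ^ (O.toAddSubgroup.index.factorization p)) ^ (w * k) *
      (if p ∣ O.toAddSubgroup.index then ((p : ℝ) ^ j) ^ ((1 - w) * k / 2) else 1) := by
  set M := O.toAddSubgroup.index
  set v := M.factorization p
  set H := Nat.card (O →+* ZMod (p ^ j))
  have hp1 : (1 : ℝ) ≤ p := by exact_mod_cast hp.one_le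
  have hp0 : (0 : ℝ) < p := by linarith
  have h1 : H ≤ (2 * p ^ (j / 2)) ^ k :=
    (finite_and_card_le_of_finset (card_ringHom_le_sqrt hp j k O)).2
  have h2 : H ≤ (k + 1) * (p ^ v) ^ k :=
    (finite_and_card_le_of_finset (card_ringHom_le_index hp j k O hO)).2
  have hk : ((k : ℝ) + 1) ≤ 2 ^ k := by exact_mod_cast Nat.lt_two_pow_self
  have h2' : (H : ℝ) ≤ 2 ^ k * ((p : ℝ) ^ v) ^ (k : ℝ) := by
    rw [Real.rpow_natCast]
    calc (H : ℝ) ≤ ((k : ℝ) + 1) * ((p : ℝ) ^ v) ^ k := by exact_mod_cast h2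
      _ ≤ _ := by gcongr
  split_ifs with hdvd
  · have h1' : (H : ℝ) ≤ 2 ^ k * ((p : ℝ) ^ j) ^ ((k : ℝ) / 2) := by
      calc (H : ℝ) ≤ (2 * (p : ℝ) ^ (j / 2)) ^ k := by exact_mod_cast h1
        _ = 2 ^ k * ((p : ℝ) ^ (j / 2)) ^ k := mul_pow _ _ _
        _ ≤ _ := by
          gcongr
          rw [← Real.rpow_natCast (p : ℝ) j, ← Real.rpow_mul hp0.le, ← pow_mul,
            ← Real.rpow_natCast (p : ℝ)]
          refine Real.rpow_le_rpow_of_exponent_le hp1 ?_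
          have : (((j / 2 : ℕ) : ℝ)) ≤ j / 2 := Nat.cast_div_le
          push_cast
          nlinarith [(Nat.cast_nonneg k : (0 : ℝ) ≤ k)]
    rcases Nat.eq_zero_or_pos H with hH | hH
    · rw [hH]; push_cast; positivity
    have hHpos : (0 : ℝ) < H := by exact_mod_cast hH
    calc (H : ℝ) = (H : ℝ) ^ w * (H : ℝ) ^ (1 - w) := by
          rw [← Real.rpow_add hHpos]; simp
      _ ≤ (2 ^ k * ((p : ℝ) ^ v) ^ (k : ℝ)) ^ w *
          (2 ^ k * ((p : ℝ) ^ j) ^ ((k : ℝ) / 2)) ^ (1 - w) := by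
          have : 0 ≤ 1 - w := by linarith
          gcongr
      _ = ((2 ^ k : ℝ) ^ w * (2 ^ k : ℝ) ^ (1 - w)) * ((p : ℝ) ^ v) ^ (w * k) *
          ((p : ℝ) ^ j) ^ ((1 - w) * k / 2) := by
          rw [Real.mul_rpow (by positivity) (by positivity),
            Real.mul_rpow (by positivity) (by positivity), ← Real.rpow_mul (by positivity),
            ← Real.rpow_mul (by positivity)]
          rw [mul_comm (k : ℝ) w, show (k : ℝ) / 2 * (1 - w) = (1 - w) * k / 2 by ring]
          ring
      _ = _ := by
          rw [← Real.rpow_add (by positivity)]; simp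
  · have hv : v = 0 := Nat.factorization_eq_zero_of_not_dvd hdvd
    rw [hv] at h2' ⊢
    simpa using h2'

/-- The part of `n` composed of primes dividing `m`. -/
def commonPart (m n : ℕ) : ℕ := ∏ p ∈ n.primeFactors with p ∣ m, p ^ n.factorization p

/-- The part of `n` composed of primes not dividing `m`. -/
def coprimePart (m n : ℕ) : ℕ := ∏ p ∈ n.primeFactors with ¬ p ∣ m, p ^ n.factorization p

lemma commonPart_mul_coprimePart (m : ℕ) {n : ℕ} (hn : n ≠ 0) :
    commonPart m n * coprimePart m n = n := by
  rw [commonPart, coprimePart, Finset.prod_filter_mul_prod_filter_not]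
  exact Nat.prod_factorization_pow_eq_self hn

lemma commonPart_mem_factoredNumbers {m : ℕ} (hm : m ≠ 0) (n : ℕ) :
    commonPart m n ∈ Nat.factoredNumbers m.primeFactors := by
  rw [Nat.mem_factoredNumbers']
  intro q hq hdvd
  obtain ⟨p, hp, hqp⟩ := (Nat.Prime.prime hq).exists_mem_finset_dvd hdvd
  rw [Finset.mem_filter] at hp
  have : q = p := (Nat.prime_dvd_prime_iff_eq hq (Nat.prime_of_mem_primeFactors hp.1)).1
    (hq.dvd_of_dvd_pow hqp)
  subst this
  exact Nat.mem_primeFactors.2 ⟨hq, hp.2, hm⟩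

lemma prod_pow_factorization_le (s : Finset ℕ) (hs : ∀ p ∈ s, p.Prime) {m : ℕ} (hm : m ≠ 0) :
    ∏ p ∈ s, p ^ m.factorization p ≤ m := by
  calc ∏ p ∈ s, p ^ m.factorization p ≤ ∏ p ∈ s ∪ m.primeFactors, p ^ m.factorization p := by
        refine Finset.prod_le_prod_of_subset_of_one_le' Finset.subset_union_left ?_
        intro p hp hps
        have : p.Prime := by
          rcases Finset.mem_union.1 hp with h | h
          · exact hs p h
          · exact Nat.prime_of_mem_primeFactors h
        exact Nat.one_le_pow _ _ this.pos
    _ = ∏ p ∈ m.primeFactors, p ^ m.factorization p := by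
        symm
        refine Finset.prod_subset Finset.subset_union_right ?_
        intro p _ hpm
        rw [← Nat.support_factorization, Finsupp.notMem_support_iff] at hpm
        rw [hpm, pow_zero]
    _ = m := Nat.prod_factorization_pow_eq_self hm

lemma finite_ringHom_and_card_le_prod {k : ℕ} (O : Subring (Fin (k + 1) → ℤ)) {J : ℕ}
    (hJ : J ≠ 0) : Finite (O →+* ZMod J) ∧
      Nat.card (O →+* ZMod J) ≤
        ∏ p ∈ J.primeFactors, Nat.card (O →+* ZMod (p ^ J.factorization p)) := by
  have hfin : ∀ p : J.primeFactors,
      Finite (O →+* ZMod ((p : ℕ) ^ J.factorization p)) := fun p =>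
    (finite_and_card_le_of_finset
      (card_ringHom_le_sqrt (Nat.prime_of_mem_primeFactors p.2) _ k O)).1
  let F : (O →+* ZMod J) → ∀ p : J.primeFactors, (O →+* ZMod ((p : ℕ) ^ J.factorization p)) :=
    fun φ p => (Pi.evalRingHom (fun p : J.primeFactors => ZMod ((p : ℕ) ^ J.factorization p)) p).comp
      ((ZMod.equivPi J hJ).toRingHom.comp φ)
  have hF : Function.Injective F := by
    intro φ ψ h
    ext x
    apply (ZMod.equivPi J hJ).injective
    funext p
    exact DFunLike.congr_fun (congrFun h p) x
  refine ⟨Finite.of_injective F hF, (Nat.card_le_card_of_injective F hF).trans ?_⟩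
  rw [Nat.card_pi]
  exact (Finset.prod_coe_sort J.primeFactors
    fun p => Nat.card (O →+* ZMod (p ^ J.factorization p))).le

lemma card_ringHom_zmod_le {k : ℕ} (O : Subring (Fin (k + 1) → ℤ))
    (hO : O.toAddSubgroup.index ≠ 0) {w : ℝ} (hw0 : 0 ≤ w) (hw1 : w ≤ 1) {J : ℕ} (hJ : J ≠ 0) :
    (Nat.card (O →+* ZMod J) : ℝ) ≤ (2 ^ k) ^ J.primeFactors.card *
      (O.toAddSubgroup.index : ℝ) ^ (w * k) *
      (commonPart O.toAddSubgroup.index J : ℝ) ^ ((1 - w) * k / 2) := by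
  have h := (finite_ringHom_and_card_le_prod O hJ).2
  set M := O.toAddSubgroup.index with hM
  calc (Nat.card (O →+* ZMod J) : ℝ)
      ≤ ∏ p ∈ J.primeFactors, (Nat.card (O →+* ZMod (p ^ J.factorization p)) : ℝ) := by
        exact_mod_cast h
    _ ≤ ∏ p ∈ J.primeFactors, (2 ^ k * ((p : ℝ) ^ (M.factorization p)) ^ (w * k) *
          (if p ∣ M then ((p : ℝ) ^ J.factorization p) ^ ((1 - w) * k / 2) else 1)) :=
        Finset.prod_le_prod (fun _ _ => Nat.cast_nonneg _) fun p hp =>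
          card_ringHom_primePow_le (Nat.prime_of_mem_primeFactors hp) _ k O hO hw0 hw1
    _ = (2 ^ k) ^ J.primeFactors.card *
          ((∏ p ∈ J.primeFactors, p ^ M.factorization p : ℕ) : ℝ) ^ (w * k) *
          (commonPart M J : ℝ) ^ ((1 - w) * k / 2) := by
        rw [Finset.prod_mul_distrib, Finset.prod_mul_distrib, Finset.prod_const, commonPart,
          ← Finset.prod_filter]
        push_cast
        rw [Real.finsetProd_rpow _ _ (fun _ _ => by positivity),
          Real.finsetProd_rpow _ _ (fun _ _ => by positivity)]
    _ ≤ _ := by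
        have := prod_pow_factorization_le J.primeFactors
          (fun p hp => Nat.prime_of_mem_primeFactors hp) hO
        gcongr

lemma exists_pow_card_primeFactors_le {K ε : ℝ} (hK : 1 ≤ K) (hε : 0 < ε) :
    ∃ C : ℝ, 0 < C ∧ ∀ n : ℕ, n ≠ 0 → K ^ n.primeFactors.card ≤ C * (n : ℝ) ^ ε := by
  obtain ⟨P, hP⟩ := exists_nat_gt (K ^ (1 / ε))
  have hlarge : ∀ p : ℕ, P ≤ p → K ≤ (p : ℝ) ^ ε := by
    intro p hp
    have h1 : K ^ (1 / ε) ≤ p := hP.le.trans (by exact_mod_cast hp)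
    calc K = (K ^ (1 / ε)) ^ ε := by
          rw [← Real.rpow_mul (by linarith), one_div_mul_cancel hε.ne', Real.rpow_one]
      _ ≤ _ := by gcongr
  refine ⟨K ^ P, by positivity, fun n hn => ?_⟩
  calc K ^ n.primeFactors.card = ∏ p ∈ n.primeFactors, K := by rw [Finset.prod_const]
    _ ≤ ∏ p ∈ n.primeFactors, ((if p < P then K else 1) * (p : ℝ) ^ ε) := by
        refine Finset.prod_le_prod (fun _ _ => by linarith) fun p hp => ?_
        have hp1 : (1 : ℝ) ≤ (p : ℝ) ^ ε :=
          Real.one_le_rpow (by exact_mod_cast (Nat.prime_of_mem_primeFactors hp).one_le) hε.le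
        split_ifs with h
        · nlinarith
        · rw [one_mul]; exact hlarge p (not_lt.1 h)
    _ = K ^ (n.primeFactors.filter (· < P)).card * ((∏ p ∈ n.primeFactors, p : ℕ) : ℝ) ^ ε := by
        rw [Finset.prod_mul_distrib, ← Finset.prod_filter, Finset.prod_const]
        push_cast
        rw [Real.finsetProd_rpow _ _ (fun _ _ => by positivity)]
    _ ≤ _ := by
        have h1 : (n.primeFactors.filter (· < P)).card ≤ P := by
          refine (Finset.card_le_card (t := Finset.range P) ?_).trans (by simp)
          intro p hp
          exact Finset.mem_range.2 (Finset.mem_filter.1 hp).2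
        have h2 : ∏ p ∈ n.primeFactors, p ≤ n :=
          Nat.le_of_dvd (Nat.pos_of_ne_zero hn) (Nat.prod_primeFactors_dvd n)
        gcongr

/-- The sum of `b ^ (-δ)` over integers `b` composed of primes dividing `m` is `O(m ^ ε)`. -/
lemma exists_tsum_factoredNumbers_le {δ ε : ℝ} (hδ : 0 < δ) (hε : 0 < ε) :
    ∃ C : ℝ, 0 < C ∧ ∀ m : ℕ, m ≠ 0 →
      ∑' b : Nat.factoredNumbers m.primeFactors, ENNReal.ofReal (((b : ℕ) : ℝ) ^ (-δ)) ≤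
        ENNReal.ofReal (C * (m : ℝ) ^ ε) := by
  have h2 : (2 : ℝ) ^ (-δ) < 1 := Real.rpow_lt_one_of_one_lt_of_neg (by norm_num) (by linarith)
  have h2' : 0 < (2 : ℝ) ^ (-δ) := by positivity
  have hL : 1 ≤ (1 - (2 : ℝ) ^ (-δ))⁻¹ := (one_le_inv₀ (by linarith)).2 (by linarith)
  obtain ⟨C, hC, hCn⟩ := exists_pow_card_primeFactors_le hL hε
  refine ⟨C, hC, fun m hm => ?_⟩
  let f : ℕ →* ℝ :=
    { toFun := fun n => (n : ℝ) ^ (-δ)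
      map_one' := by simp
      map_mul' := fun a b => by
        push_cast; exact Real.mul_rpow (Nat.cast_nonneg _) (Nat.cast_nonneg _) }
  have hfp : ∀ {p : ℕ}, p.Prime → f p ≤ (2 : ℝ) ^ (-δ) := by
    intro p hp
    exact Real.rpow_le_rpow_of_nonpos (by norm_num) (by exact_mod_cast hp.two_le) (by linarith)
  have hf0 : ∀ n, 0 ≤ f n := fun n => Real.rpow_nonneg (Nat.cast_nonneg _) _
  have hf : ∀ {p : ℕ}, p.Prime → ‖f p‖ < 1 := by
    intro p hp
    rw [Real.norm_of_nonneg (hf0 p)]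
    exact (hfp hp).trans_lt h2
  obtain ⟨hs, hsum⟩ :=
    EulerProduct.summable_and_hasSum_factoredNumbers_prod_filter_prime_geometric hf m.primeFactors
  have h1 : ∑' b : Nat.factoredNumbers m.primeFactors, ENNReal.ofReal (((b : ℕ) : ℝ) ^ (-δ)) =
      ENNReal.ofReal (∑' b : Nat.factoredNumbers m.primeFactors, f b) :=
    (ENNReal.ofReal_tsum_of_nonneg
      (f := fun b : Nat.factoredNumbers m.primeFactors => f b) (fun b => hf0 b) hsum.summable).symm
  rw [h1, hsum.tsum_eq]
  refine ENNReal.ofReal_le_ofReal (le_trans ?_ (hCn m hm))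
  rw [← Finset.prod_const, Finset.filter_true_of_mem fun p hp => Nat.prime_of_mem_primeFactors hp]
  refine Finset.prod_le_prod (fun p hp => ?_) fun p hp => ?_
  · have := hfp (Nat.prime_of_mem_primeFactors hp)
    exact inv_nonneg.2 (by linarith)
  · have := hfp (Nat.prime_of_mem_primeFactors hp)
    exact inv_anti₀ (by linarith) (by linarith)

/-- The Dirichlet series counting homomorphisms from an order to the rings `ℤ / J`. -/
lemma exists_tsum_card_ringHom_le (k : ℕ) {w s ε : ℝ} (hw0 : 0 ≤ w) (hw1 : w ≤ 1) (hε : 0 < ε)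
    (hs1 : 1 < s) (hs2 : (1 - w) * k / 2 < s) :
    ∃ C : ℝ, 0 < C ∧ ∀ O : Subring (Fin (k + 1) → ℤ), O.toAddSubgroup.index ≠ 0 →
      ∑' J : ℕ+, (Nat.card (O →+* ZMod J) : ENNReal) * ENNReal.ofReal (((J : ℕ) : ℝ) ^ (-s)) ≤
        ENNReal.ofReal (C * (O.toAddSubgroup.index : ℝ) ^ (w * k + ε)) := by
  set β := (1 - w) * k / 2 with hβ
  obtain ⟨η, hη0, hη1, hη2⟩ : ∃ η : ℝ, 0 < η ∧ 1 < s - η ∧ 0 < s - β - η := by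
    refine ⟨min (s - 1) (s - β) / 2, ?_, ?_, ?_⟩
    · have : 0 < min (s - 1) (s - β) := lt_min (by linarith) (by linarith)
      linarith
    · have := min_le_left (s - 1) (s - β); linarith
    · have := min_le_right (s - 1) (s - β); linarith
  obtain ⟨C₁, hC₁, h₁⟩ := exists_pow_card_primeFactors_le (K := 2 ^ k) (one_le_pow₀ (by norm_num)) hη0
  obtain ⟨C₂, hC₂, h₂⟩ := exists_tsum_factoredNumbers_le hη2 hε
  have hsumm : Summable fun n : ℕ => (n : ℝ) ^ (-(s - η)) := Real.summable_nat_rpow.2 (by linarith)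
  set Z := ∑' n : ℕ, (n : ℝ) ^ (-(s - η)) with hZ
  have hZ0 : 0 ≤ Z := tsum_nonneg fun n => by positivity
  refine ⟨C₁ * (Z + 1) * C₂, by positivity, fun O hO => ?_⟩
  set M := O.toAddSubgroup.index with hM
  have hM0 : (0 : ℝ) < M := by exact_mod_cast Nat.pos_of_ne_zero hO
  let F : ℕ+ → ℕ × Nat.factoredNumbers M.primeFactors :=
    fun J => (coprimePart M J, ⟨commonPart M J, commonPart_mem_factoredNumbers hO J⟩)
  have hF : Function.Injective F := by
    intro J J' h
    have h1 := congrArg Prod.fst h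
    have h2 := congrArg (fun x => ((Prod.snd x : Nat.factoredNumbers M.primeFactors) : ℕ)) h
    apply PNat.eq
    rw [← commonPart_mul_coprimePart M J.ne_zero, ← commonPart_mul_coprimePart M J'.ne_zero]
    simp only [F] at h1 h2
    rw [h1, h2]
  have hterm : ∀ J : ℕ+,
      (Nat.card (O →+* ZMod J) : ENNReal) * ENNReal.ofReal (((J : ℕ) : ℝ) ^ (-s)) ≤
        ENNReal.ofReal (C₁ * (M : ℝ) ^ (w * k)) *
          (ENNReal.ofReal (((F J).1 : ℝ) ^ (-(s - η))) *
            ENNReal.ofReal ((((F J).2 : ℕ) : ℝ) ^ (-(s - β - η)))) := by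
    intro J
    rw [← ENNReal.ofReal_natCast, ← ENNReal.ofReal_mul (Nat.cast_nonneg _),
      ← ENNReal.ofReal_mul (by positivity), ← ENNReal.ofReal_mul (by positivity)]
    refine ENNReal.ofReal_le_ofReal ?_
    have hJ := commonPart_mul_coprimePart M J.ne_zero
    have hb := card_ringHom_zmod_le O hO hw0 hw1 J.ne_zero
    have hω := h₁ J J.ne_zero
    change _ ≤ C₁ * (M : ℝ) ^ (w * k) * ((coprimePart M J : ℝ) ^ (-(s - η)) *
      (commonPart M J : ℝ) ^ (-(s - β - η)))
    rw [← hM, ← hβ] at hb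
    set a := coprimePart M J
    set b := commonPart M J
    have ha0 : (0 : ℝ) < a := by
      rw [Nat.cast_pos]; rcases Nat.eq_zero_or_pos a with h | h
      · rw [h, mul_zero] at hJ; exact absurd hJ.symm J.ne_zero
      · exact h
    have hb0 : (0 : ℝ) < b := by
      rw [Nat.cast_pos]; rcases Nat.eq_zero_or_pos b with h | h
      · rw [h, zero_mul] at hJ; exact absurd hJ.symm J.ne_zero
      · exact h
    have hJr : ((J : ℕ) : ℝ) = b * a := by exact_mod_cast hJ.symm
    calc (Nat.card (O →+* ZMod J) : ℝ) * ((J : ℕ) : ℝ) ^ (-s)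
        ≤ (C₁ * ((J : ℕ) : ℝ) ^ η * (M : ℝ) ^ (w * k) * (b : ℝ) ^ β) * ((J : ℕ) : ℝ) ^ (-s) := by
          refine mul_le_mul_of_nonneg_right (hb.trans ?_) (by positivity)
          gcongr
      _ = C₁ * (M : ℝ) ^ (w * k) * ((a ^ η * a ^ (-s)) * (b ^ η * b ^ β * b ^ (-s))) := by
          rw [hJr, Real.mul_rpow hb0.le ha0.le, Real.mul_rpow hb0.le ha0.le]; ring
      _ = _ := by
          rw [← Real.rpow_add ha0, ← Real.rpow_add hb0, ← Real.rpow_add hb0]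
          congr 3 <;> ring_nf
  calc _ ≤ ∑' J : ℕ+, ENNReal.ofReal (C₁ * (M : ℝ) ^ (w * k)) *
          (ENNReal.ofReal (((F J).1 : ℝ) ^ (-(s - η))) *
            ENNReal.ofReal ((((F J).2 : ℕ) : ℝ) ^ (-(s - β - η)))) := ENNReal.tsum_le_tsum hterm
    _ = ENNReal.ofReal (C₁ * (M : ℝ) ^ (w * k)) * ∑' J : ℕ+,
          (ENNReal.ofReal (((F J).1 : ℝ) ^ (-(s - η))) *
            ENNReal.ofReal ((((F J).2 : ℕ) : ℝ) ^ (-(s - β - η)))) := ENNReal.tsum_mul_left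
    _ ≤ ENNReal.ofReal (C₁ * (M : ℝ) ^ (w * k)) *
          ∑' x : ℕ × Nat.factoredNumbers M.primeFactors,
          (ENNReal.ofReal ((x.1 : ℝ) ^ (-(s - η))) *
            ENNReal.ofReal (((x.2 : ℕ) : ℝ) ^ (-(s - β - η)))) := by
        gcongr
        exact ENNReal.tsum_comp_le_tsum_of_injective hF _
    _ = ENNReal.ofReal (C₁ * (M : ℝ) ^ (w * k)) *
          ((∑' n : ℕ, ENNReal.ofReal ((n : ℝ) ^ (-(s - η)))) *
            ∑' b : Nat.factoredNumbers M.primeFactors,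
              ENNReal.ofReal (((b : ℕ) : ℝ) ^ (-(s - β - η)))) := by
        rw [ENNReal.tsum_prod']
        simp only [ENNReal.tsum_mul_left, ENNReal.tsum_mul_right]
    _ ≤ ENNReal.ofReal (C₁ * (M : ℝ) ^ (w * k)) *
          (ENNReal.ofReal (Z + 1) * ENNReal.ofReal (C₂ * (M : ℝ) ^ ε)) := by
        have hz : ∑' n : ℕ, ENNReal.ofReal ((n : ℝ) ^ (-(s - η))) ≤ ENNReal.ofReal (Z + 1) := by
          rw [← ENNReal.ofReal_tsum_of_nonneg (fun n => by positivity) hsumm]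
          exact ENNReal.ofReal_le_ofReal (by linarith)
        have := h₂ M hO
        gcongr
    _ = _ := by
        rw [← ENNReal.ofReal_mul (by positivity), ← ENNReal.ofReal_mul (by positivity),
          Real.rpow_add hM0]
        congr 1; ring

/-- The orders of `ℤ ^ r`. -/
abbrev OrderZ (r : ℕ) := {O : Subring (Fin r → ℤ) // O.toAddSubgroup.index ≠ 0}

/-- Forgetting the first coordinate. -/
def tailHom (n : ℕ) : (Fin (n + 1) → ℤ) →+* (Fin n → ℤ) :=
  RingHom.pi fun i => Pi.evalRingHom (fun _ : Fin (n + 1) => ℤ) i.succ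

lemma tailHom_apply {n : ℕ} (x : Fin (n + 1) → ℤ) (i : Fin n) : tailHom n x i = x i.succ := rfl

lemma tailHom_surjective (n : ℕ) : Function.Surjective (tailHom n) := fun v =>
  ⟨Fin.cons 0 v, by ext i; simp [tailHom_apply]⟩

lemma eq_single_of_tailHom_eq_zero {n : ℕ} {x : Fin (n + 1) → ℤ} (h : tailHom n x = 0) :
    Pi.single 0 (x 0) = x := by
  ext i
  refine Fin.cases ?_ (fun i => ?_) i
  · simp
  · have := congrFun h i
    rw [tailHom_apply] at this
    simp [this]

/-- The integers `z` for which `(z, 0, …, 0)` lies in `O`. -/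
def firstAxis {n : ℕ} (O : Subring (Fin (n + 1) → ℤ)) : AddSubgroup ℤ :=
  O.toAddSubgroup.comap (AddMonoidHom.single (fun _ : Fin (n + 1) => ℤ) 0)

lemma mem_firstAxis {n : ℕ} {O : Subring (Fin (n + 1) → ℤ)} {z : ℤ} :
    z ∈ firstAxis O ↔ Pi.single 0 z ∈ O := Iff.rfl

lemma index_map_tailHom_mul {n : ℕ} (O : Subring (Fin (n + 1) → ℤ)) :
    (O.map (tailHom n)).toAddSubgroup.index * (firstAxis O).index = O.toAddSubgroup.index := by
  set H := O.toAddSubgroup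
  set f : (Fin (n + 1) → ℤ) →+ (Fin n → ℤ) := (tailHom n).toAddMonoidHom
  have h1 : (O.map (tailHom n)).toAddSubgroup = H.map f := rfl
  have hker : f.ker = (AddMonoidHom.single (fun _ : Fin (n + 1) => ℤ) 0).range := by
    ext x
    rw [AddMonoidHom.mem_ker, AddMonoidHom.mem_range]
    constructor
    · intro h; exact ⟨x 0, eq_single_of_tailHom_eq_zero h⟩
    · rintro ⟨z, rfl⟩
      ext i
      change (Pi.single 0 z : Fin (n + 1) → ℤ) i.succ = 0
      simp
  have hrange : f.range = ⊤ := AddMonoidHom.range_eq_top.2 (tailHom_surjective n)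
  rw [h1, AddSubgroup.index_map, hrange, AddSubgroup.index_top, mul_one, firstAxis,
    AddSubgroup.index_comap, ← hker, ← AddSubgroup.relIndex_sup_left, mul_comm,
    AddSubgroup.relIndex_mul_index le_sup_left]

lemma mem_iff_index_dvd (H : AddSubgroup ℤ) (z : ℤ) : z ∈ H ↔ (H.index : ℤ) ∣ z := by
  obtain ⟨a, rfl⟩ := Int.subgroup_cyclic H
  rw [← AddSubgroup.zmultiples_eq_closure, Int.index_zmultiples, Int.mem_zmultiples_iff,
    Int.natCast_natAbs, abs_dvd]

/-- The projection of an order onto its image under `tailHom`. -/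
def toMapTail {n : ℕ} (O : Subring (Fin (n + 1) → ℤ)) : O →+* O.map (tailHom n) :=
  ((tailHom n).comp O.subtype).codRestrict _ fun x => ⟨x, x.2, rfl⟩

lemma toMapTail_surjective {n : ℕ} (O : Subring (Fin (n + 1) → ℤ)) :
    Function.Surjective (toMapTail O) := by
  rintro ⟨_, x, hx, rfl⟩
  exact ⟨⟨x, hx⟩, rfl⟩

/-- The first coordinate modulo the index of `firstAxis O`. -/
noncomputable def firstCoordHom {n : ℕ} (O : Subring (Fin (n + 1) → ℤ)) : O →+* ZMod (firstAxis O).index :=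
  (Int.castRingHom _).comp ((Pi.evalRingHom (fun _ : Fin (n + 1) => ℤ) 0).comp O.subtype)

lemma firstCoordHom_apply {n : ℕ} (O : Subring (Fin (n + 1) → ℤ)) (x : O) :
    firstCoordHom O x = ((x : Fin (n + 1) → ℤ) 0 : ZMod (firstAxis O).index) := rfl

lemma ker_toMapTail_le {n : ℕ} (O : Subring (Fin (n + 1) → ℤ)) :
    RingHom.ker (toMapTail O) ≤ RingHom.ker (firstCoordHom O) := by
  intro x hx
  rw [RingHom.mem_ker] at hx ⊢
  have h0 : tailHom n x = 0 := congrArg Subtype.val hx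
  rw [firstCoordHom_apply, ZMod.intCast_zmod_eq_zero_iff_dvd, ← mem_iff_index_dvd, mem_firstAxis,
    eq_single_of_tailHom_eq_zero h0]
  exact x.2

/-- The homomorphism of which `O` is the graph. -/
noncomputable def graphHom {n : ℕ} (O : Subring (Fin (n + 1) → ℤ)) :
    O.map (tailHom n) →+* ZMod (firstAxis O).index :=
  RingHom.liftOfSurjective (toMapTail O) (toMapTail_surjective O)
    ⟨firstCoordHom O, ker_toMapTail_le O⟩

lemma graphHom_toMapTail {n : ℕ} (O : Subring (Fin (n + 1) → ℤ)) (x : O) :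
    graphHom O (toMapTail O x) = firstCoordHom O x :=
  RingHom.liftOfRightInverse_comp_apply _ _ _ _ _

lemma mem_iff_graphHom {n : ℕ} (O : Subring (Fin (n + 1) → ℤ)) (x : Fin (n + 1) → ℤ) :
    x ∈ O ↔ ∃ h : tailHom n x ∈ O.map (tailHom n),
      graphHom O ⟨tailHom n x, h⟩ = (x 0 : ZMod (firstAxis O).index) := by
  constructor
  · intro hx
    exact ⟨⟨x, hx, rfl⟩, graphHom_toMapTail O ⟨x, hx⟩⟩
  · rintro ⟨⟨y, hy, hyx⟩, h⟩
    have h1 : graphHom O ⟨tailHom n x, ⟨y, hy, hyx⟩⟩ = firstCoordHom O ⟨y, hy⟩ := by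
      rw [← graphHom_toMapTail]
      congr 1
      exact Subtype.ext hyx.symm
    rw [h1, firstCoordHom_apply, ← sub_eq_zero, ← Int.cast_sub,
      ZMod.intCast_zmod_eq_zero_iff_dvd, ← mem_iff_index_dvd, mem_firstAxis] at h
    have h0 : tailHom n (y - x) = 0 := by rw [map_sub, sub_eq_zero]; exact hyx
    have h2 := eq_single_of_tailHom_eq_zero h0
    rw [Pi.sub_apply] at h2
    rw [h2] at h
    simpa using O.sub_mem hy h

lemma index_map_tailHom_ne_zero {n : ℕ} (O : OrderZ (n + 1)) :
    (O.1.map (tailHom n)).toAddSubgroup.index ≠ 0 := fun h => O.2 (by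
  rw [← index_map_tailHom_mul, h, zero_mul])

lemma index_firstAxis_pos {n : ℕ} (O : OrderZ (n + 1)) : 0 < (firstAxis O.1).index :=
  Nat.pos_of_ne_zero fun h => O.2 (by rw [← index_map_tailHom_mul, h, mul_zero])

/-- An order is encoded by its projection, the index of its first axis, and a homomorphism. -/
noncomputable def orderCode {n : ℕ} (O : OrderZ (n + 1)) :
    Σ O' : OrderZ n, Σ J : ℕ+, (O'.1 →+* ZMod J) :=
  ⟨⟨O.1.map (tailHom n), index_map_tailHom_ne_zero O⟩,
    ⟨(firstAxis O.1).index, index_firstAxis_pos O⟩, graphHom O.1⟩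

lemma orderCode_injective (n : ℕ) : Function.Injective (orderCode (n := n)) := by
  let g : (Σ O' : OrderZ n, Σ J : ℕ+, (O'.1 →+* ZMod J)) → Set (Fin (n + 1) → ℤ) :=
    fun c => {x | ∃ h : tailHom n x ∈ c.1.1, c.2.2 ⟨tailHom n x, h⟩ = (x 0 : ZMod c.2.1)}
  have hg : ∀ O : OrderZ (n + 1), g (orderCode O) = (O.1 : Set (Fin (n + 1) → ℤ)) := by
    intro O
    ext x
    exact (mem_iff_graphHom O.1 x).symm
  intro O O' h
  apply Subtype.ext
  apply SetLike.coe_injective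
  rw [← hg, ← hg, h]

/-- The zeta function of the orders of `ℤ ^ r`. -/
noncomputable def orderZeta (r : ℕ) (s : ℝ) : ENNReal :=
  ∑' O : OrderZ r, ENNReal.ofReal ((O.1.toAddSubgroup.index : ℝ) ^ (-s))

lemma orderZeta_succ_le (n : ℕ) (s : ℝ) :
    orderZeta (n + 2) s ≤ ∑' O : OrderZ (n + 1),
      ENNReal.ofReal ((O.1.toAddSubgroup.index : ℝ) ^ (-s)) *
        ∑' J : ℕ+, (Nat.card (O.1 →+* ZMod J) : ENNReal) *
          ENNReal.ofReal (((J : ℕ) : ℝ) ^ (-s)) := by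
  let F : (Σ O' : OrderZ (n + 1), Σ J : ℕ+, (O'.1 →+* ZMod J)) → ENNReal := fun c =>
    ENNReal.ofReal ((c.1.1.toAddSubgroup.index : ℝ) ^ (-s)) *
      ENNReal.ofReal (((c.2.1 : ℕ) : ℝ) ^ (-s))
  calc orderZeta (n + 2) s = ∑' O : OrderZ (n + 2), F (orderCode O) := by
        refine tsum_congr fun O => ?_
        change _ = ENNReal.ofReal (((O.1.map (tailHom (n + 1))).toAddSubgroup.index : ℝ) ^ (-s)) *
          ENNReal.ofReal (((firstAxis O.1).index : ℝ) ^ (-s))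
        rw [← ENNReal.ofReal_mul (by positivity),
          ← Real.mul_rpow (Nat.cast_nonneg _) (Nat.cast_nonneg _), ← Nat.cast_mul,
          index_map_tailHom_mul]
    _ ≤ ∑' c, F c := ENNReal.tsum_comp_le_tsum_of_injective (orderCode_injective _) F
    _ = _ := by
        rw [ENNReal.tsum_sigma']
        refine tsum_congr fun O => ?_
        rw [ENNReal.tsum_sigma', ← ENNReal.tsum_mul_left]
        refine tsum_congr fun J => ?_
        have := (finite_ringHom_and_card_le_prod O.1 J.ne_zero).1
        have := Fintype.ofFinite (O.1 →+* ZMod J)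
        simp only [F]
        rw [tsum_fintype, Finset.sum_const, Nat.card_eq_fintype_card, nsmul_eq_mul,
          Finset.card_univ]
        ring

lemma orderZeta_one_lt_top (s : ℝ) : orderZeta 1 s < ⊤ := by
  have : Subsingleton (OrderZ 1) := by
    have h : ∀ O : Subring (Fin 1 → ℤ), O = ⊤ := by
      intro O
      rw [eq_top_iff]
      intro x _
      have hx : x = ((x 0 : ℤ) : Fin 1 → ℤ) := by
        ext i; rw [Subsingleton.elim i 0]; simp
      rw [hx]; exact intCast_mem O _
    exact ⟨fun O O' => Subtype.ext ((h O.1).trans (h O'.1).symm)⟩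
  have : Fintype (OrderZ 1) := Fintype.ofFinite _
  rw [orderZeta, tsum_fintype]
  exact ENNReal.sum_lt_top.2 fun _ _ => ENNReal.ofReal_lt_top

/-- The inductive bound for the abscissa of convergence. -/
lemma orderZeta_lt_top_succ (k : ℕ) {θ θ' w : ℝ} (hw0 : 0 ≤ w) (hw1 : w ≤ 1) (h1 : 1 ≤ θ')
    (h2 : (1 - w) * k / 2 ≤ θ') (h3 : θ + w * k ≤ θ')
    (ih : ∀ s, θ < s → orderZeta (k + 1) s < ⊤) (s : ℝ) (hs : θ' < s) :
    orderZeta (k + 2) s < ⊤ := by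
  have hε : 0 < (s - θ') / 2 := by linarith
  obtain ⟨C, hC, hCO⟩ := exists_tsum_card_ringHom_le k hw0 hw1 hε (h1.trans_lt hs) (h2.trans_lt hs)
  refine (orderZeta_succ_le k s).trans_lt ?_
  calc _ ≤ ∑' O : OrderZ (k + 1), ENNReal.ofReal C *
        ENNReal.ofReal ((O.1.toAddSubgroup.index : ℝ) ^ (-(s - w * k - (s - θ') / 2))) := by
        refine ENNReal.tsum_le_tsum fun O => ?_
        refine (mul_le_mul_right (hCO O.1 O.2) _).trans ?_
        have hM0 : (0 : ℝ) < O.1.toAddSubgroup.index := by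
          exact_mod_cast Nat.pos_of_ne_zero O.2
        rw [← ENNReal.ofReal_mul (by positivity), ← ENNReal.ofReal_mul hC.le]
        refine le_of_eq (congrArg _ ?_)
        rw [mul_left_comm, ← Real.rpow_add hM0]
        congr 2; ring
    _ = ENNReal.ofReal C * orderZeta (k + 1) (s - w * k - (s - θ') / 2) := ENNReal.tsum_mul_left
    _ < ⊤ := ENNReal.mul_lt_top ENNReal.ofReal_lt_top (ih _ (by linarith))

lemma orderZeta_four_lt_top (s : ℝ) (hs : 1 < s) : orderZeta 4 s < ⊤ := by
  have h : ∀ k : ℕ, k ≤ 3 → ∀ s : ℝ, 1 < s → orderZeta (k + 1) s < ⊤ := by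
    intro k
    induction k with
    | zero => intro _ s _; exact orderZeta_one_lt_top s
    | succ k ih =>
      intro hk s hs
      have hk' : (k : ℝ) ≤ 2 := by exact_mod_cast Nat.le_of_succ_le_succ hk
      exact orderZeta_lt_top_succ k le_rfl zero_le_one le_rfl (by linarith) (by simp)
        (ih (by omega)) s hs
  exact h 3 le_rfl s hs

lemma orderZeta_lt_top (k : ℕ) :
    ∀ s : ℝ, ((k + 5 : ℕ) : ℝ) / 2 - 7 / 6 < s → orderZeta (k + 5) s < ⊤ := by
  induction k with
  | zero =>
    intro s hs
    refine orderZeta_lt_top_succ 3 (θ := 1) (θ' := 4 / 3) (w := 1 / 9) (by norm_num) (by norm_num)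
      (by norm_num) (by norm_num) (by norm_num) orderZeta_four_lt_top s ?_
    norm_num at hs ⊢
    linarith
  | succ k ih =>
    intro s hs
    have hk : (0 : ℝ) ≤ k := Nat.cast_nonneg k
    have hk4 : ((k + 4 : ℕ) : ℝ) = k + 4 := by push_cast; ring
    have hw : 1 / (2 * ((k : ℝ) + 4)) * ((k + 4 : ℕ) : ℝ) = 1 / 2 := by
      rw [hk4]; field_simp
    refine orderZeta_lt_top_succ (k + 4) (w := 1 / (2 * ((k : ℝ) + 4))) (by positivity) ?_ ?_ ?_ ?_
      ih s hs
    · rw [div_le_one (by positivity)]; linarith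
    · push_cast; linarith
    · rw [sub_mul, hw]; push_cast; linarith
    · rw [hw]; push_cast; linarith

lemma summable_index_rpow {r : ℕ} {s : ℝ} (h : orderZeta r s < ⊤) :
    Summable fun O : OrderZ r => (O.1.toAddSubgroup.index : ℝ) ^ (-s) := by
  have := ENNReal.summable_toReal h.ne
  refine this.congr fun O => ?_
  rw [ENNReal.toReal_ofReal (by positivity)]

lemma numOrdersZ_eq (d : ℕ) (B : ℝ) :
    numOrdersZ d B = Nat.card {O : OrderZ d // (O.1.toAddSubgroup.index : ℝ) ≤ B} :=
  Nat.card_congr (Equiv.subtypeSubtypeEquivSubtypeInter _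
    (fun O : Subring (Fin d → ℤ) => (O.toAddSubgroup.index : ℝ) ≤ B)).symm

lemma finite_orders_and_card_le {d : ℕ} {s : ℝ} (hs0 : 0 ≤ s) (h : orderZeta d s < ⊤) {B : ℝ}
    (hB : 0 < B) : Finite {O : OrderZ d // (O.1.toAddSubgroup.index : ℝ) ≤ B} ∧
      (numOrdersZ d B : ℝ) ≤ (∑' O : OrderZ d, (O.1.toAddSubgroup.index : ℝ) ^ (-s)) * B ^ s := by
  have hsum := summable_index_rpow h
  set Z := ∑' O : OrderZ d, (O.1.toAddSubgroup.index : ℝ) ^ (-s)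
  have key : ∀ S : Finset {O : OrderZ d // (O.1.toAddSubgroup.index : ℝ) ≤ B},
      (S.card : ℝ) ≤ Z * B ^ s := by
    intro S
    have h1 : (S.card : ℝ) * B ^ (-s) ≤ Z := by
      calc (S.card : ℝ) * B ^ (-s) = ∑ _O ∈ S, B ^ (-s) := by rw [Finset.sum_const, nsmul_eq_mul]
        _ ≤ ∑ O ∈ S, (O.1.1.toAddSubgroup.index : ℝ) ^ (-s) := by
            refine Finset.sum_le_sum fun O _ => ?_
            exact Real.rpow_le_rpow_of_nonpos
              (by exact_mod_cast Nat.pos_of_ne_zero O.1.2) O.2 (by linarith)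
        _ = ∑ O ∈ S.map (Function.Embedding.subtype _),
              (O.1.toAddSubgroup.index : ℝ) ^ (-s) := by rw [Finset.sum_map]; rfl
        _ ≤ Z := hsum.sum_le_tsum _ fun _ _ => by positivity
    calc (S.card : ℝ) = S.card * B ^ (-s) * B ^ s := by
          rw [mul_assoc, ← Real.rpow_add hB]; simp
      _ ≤ _ := by gcongr
  obtain ⟨hfin, hcard⟩ := finite_and_card_le_of_finset (n := ⌊Z * B ^ s⌋₊)
    fun S => Nat.le_floor (key S)
  refine ⟨hfin, ?_⟩
  rw [numOrdersZ_eq]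
  have hZ : 0 ≤ Z := tsum_nonneg fun _ => by positivity
  exact (Nat.cast_le.2 hcard).trans (Nat.floor_le (by positivity))

lemma exists_numOrdersZ_le (d : ℕ) (hd : 6 ≤ d) {ε : ℝ} (hε : 0 < ε) :
    ∃ C : ℝ, 0 < C ∧ ∀ᶠ B : ℝ in Filter.atTop,
      (numOrdersZ d B : ℝ) ≤ C * B ^ ((d : ℝ) / 2 - 7 / 6 + ε) := by
  obtain ⟨k, rfl⟩ := Nat.exists_eq_add_of_le' (show 5 ≤ d by omega)
  have hd' : (6 : ℝ) ≤ ((k + 5 : ℕ) : ℝ) := by exact_mod_cast hd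
  set s := ((k + 5 : ℕ) : ℝ) / 2 - 7 / 6 + ε with hs
  have h := orderZeta_lt_top k s (by linarith)
  have hZ : 0 ≤ ∑' O : OrderZ (k + 5), (O.1.toAddSubgroup.index : ℝ) ^ (-s) :=
    tsum_nonneg fun _ => by positivity
  refine ⟨(∑' O : OrderZ (k + 5), (O.1.toAddSubgroup.index : ℝ) ^ (-s)) + 1, by linarith, ?_⟩
  filter_upwards [Filter.eventually_gt_atTop 0] with B hB
  refine (finite_orders_and_card_le (by linarith) h hB).2.trans ?_
  gcongr
  linarith

/-- The `D`-tuples of positive integers with product at most `x`. -/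
noncomputable def tuples (D : ℕ) (x : ℝ) : Finset (Fin D → ℕ) :=
  (Fintype.piFinset fun _ => Finset.Icc 1 ⌊x⌋₊).filter fun m => ((∏ i, m i : ℕ) : ℝ) ≤ x

lemma mem_tuples {D : ℕ} {x : ℝ} {m : Fin D → ℕ} :
    m ∈ tuples D x ↔ (∀ i, 1 ≤ m i) ∧ ((∏ i, m i : ℕ) : ℝ) ≤ x := by
  rw [tuples, Finset.mem_filter, Fintype.mem_piFinset]
  constructor
  · rintro ⟨h1, h2⟩
    exact ⟨fun i => (Finset.mem_Icc.1 (h1 i)).1, h2⟩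
  · rintro ⟨h1, h2⟩
    refine ⟨fun i => Finset.mem_Icc.2 ⟨h1 i, Nat.le_floor (le_trans ?_ h2)⟩, h2⟩
    exact_mod_cast Finset.single_le_prod' (fun j _ => h1 j) (Finset.mem_univ i)

lemma tuples_mono (D : ℕ) {x y : ℝ} (h : x ≤ y) : tuples D x ⊆ tuples D y := fun _ hm =>
  mem_tuples.2 ⟨(mem_tuples.1 hm).1, (mem_tuples.1 hm).2.trans h⟩

lemma tuples_eq_empty (D : ℕ) {x : ℝ} (hx : x < 1) : tuples D x = ∅ := by
  rw [Finset.eq_empty_iff_forall_notMem]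
  intro m hm
  rw [mem_tuples] at hm
  have h1 : (1 : ℝ) ≤ ((∏ i, m i : ℕ) : ℝ) := by
    exact_mod_cast Finset.one_le_prod' fun i _ => hm.1 i
  linarith [hm.2]

lemma card_tuples_succ (D : ℕ) (x : ℝ) :
    (tuples (D + 1) x).card = ∑ a ∈ Finset.Icc 1 ⌊x⌋₊, (tuples D (x / a)).card := by
  rw [Finset.card_eq_sum_card_fiberwise (f := fun m => m 0) (t := Finset.Icc 1 ⌊x⌋₊)]
  · refine Finset.sum_congr rfl fun a ha => ?_
    have ha1 : 1 ≤ a := (Finset.mem_Icc.1 ha).1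
    have ha0 : (0 : ℝ) < a := by exact_mod_cast ha1
    refine Finset.card_nbij' (fun m => Fin.tail m) (fun m => Fin.cons a m) ?_ ?_ ?_ ?_
    · intro m hm
      simp only [Finset.coe_filter, Set.mem_ofPred_eq, mem_tuples] at hm
      obtain ⟨⟨h1, h2⟩, rfl⟩ := hm
      rw [Finset.mem_coe, mem_tuples, le_div_iff₀ ha0]
      refine ⟨fun i => h1 i.succ, ?_⟩
      rw [Fin.prod_univ_succ] at h2
      rw [mul_comm]
      exact_mod_cast h2
    · intro m hm
      rw [Finset.mem_coe, mem_tuples, le_div_iff₀ ha0] at hm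
      simp only [Finset.coe_filter, Set.mem_ofPred_eq, mem_tuples]
      refine ⟨⟨fun i => ?_, ?_⟩, by simp⟩
      · refine Fin.cases ?_ (fun i => ?_) i
        · simpa using ha1
        · simpa using hm.1 i
      · rw [Fin.prod_univ_succ]
        simp only [Fin.cons_zero, Fin.cons_succ]
        push_cast
        have := hm.2
        push_cast at this
        linarith
    · intro m hm
      simp only [Finset.coe_filter, Set.mem_ofPred_eq] at hm
      rw [← hm.2]
      exact Fin.cons_self_tail m
    · intro m _
      exact Fin.tail_cons _ _
  · intro m hm
    rw [Finset.mem_coe, tuples, Finset.mem_filter, Fintype.mem_piFinset] at hm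
    exact hm.1 0

lemma card_tuples_zero {x : ℝ} (hx : 1 ≤ x) : (tuples 0 x).card = 1 := by
  have h : tuples 0 x = {finZeroElim} := by
    ext m
    rw [mem_tuples, Finset.mem_singleton]
    exact ⟨fun _ => Subsingleton.elim _ _, fun _ => ⟨fun i => i.elim0, by simpa using hx⟩⟩
  rw [h, Finset.card_singleton]

lemma card_tuples_one {x : ℝ} : (tuples 1 x).card = ⌊x⌋₊ := by
  rw [card_tuples_succ, Finset.sum_congr rfl (g := fun _ => 1), Finset.sum_const, Nat.card_Icc]
  · simp
  · intro a ha
    rw [Finset.mem_Icc] at ha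
    have ha0 : (0 : ℝ) < a := by exact_mod_cast ha.1
    exact card_tuples_zero ((one_le_div ha0).2 ((Nat.le_floor_iff' (by omega)).1 ha.2))

lemma sum_one_div_eq_harmonic (n : ℕ) :
    ∑ a ∈ Finset.Icc 1 n, (1 : ℝ) / a = (harmonic n : ℚ) := by
  rw [harmonic_eq_sum_Icc]; push_cast; simp

lemma card_tuples_le (n : ℕ) : ∀ x : ℝ, 1 ≤ x →
    ((tuples (n + 1) x).card : ℝ) ≤ x * (1 + Real.log x) ^ n := by
  induction n with
  | zero =>
    intro x hx
    rw [card_tuples_one, pow_zero, mul_one]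
    exact Nat.floor_le (by linarith)
  | succ n ih =>
    intro x hx
    have hlog : 0 ≤ Real.log x := Real.log_nonneg hx
    rw [card_tuples_succ]
    push_cast
    calc ∑ a ∈ Finset.Icc 1 ⌊x⌋₊, ((tuples (n + 1) (x / a)).card : ℝ)
        ≤ ∑ a ∈ Finset.Icc 1 ⌊x⌋₊, x * (1 + Real.log x) ^ n * (1 / a) := by
          refine Finset.sum_le_sum fun a ha => ?_
          rw [Finset.mem_Icc] at ha
          have ha1 : (1 : ℝ) ≤ a := by exact_mod_cast ha.1
          have hxa : 1 ≤ x / a :=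
            (one_le_div (by linarith)).2 ((Nat.le_floor_iff' (by omega)).1 ha.2)
          have h0 : 0 ≤ Real.log (x / a) := Real.log_nonneg hxa
          calc _ ≤ x / a * (1 + Real.log (x / a)) ^ n := ih _ hxa
            _ ≤ x / a * (1 + Real.log x) ^ n := by
              have : x / a ≤ x := div_le_self (by linarith) ha1
              gcongr
            _ = _ := by ring
      _ = x * (1 + Real.log x) ^ n * (harmonic ⌊x⌋₊ : ℚ) := by
          rw [← Finset.mul_sum, sum_one_div_eq_harmonic]
      _ ≤ x * (1 + Real.log x) ^ n * (1 + Real.log x) := by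
          gcongr
          exact harmonic_floor_le_one_add_log x hx
      _ = _ := by ring

lemma exists_le_card_tuples (n : ℕ) : ∃ c : ℝ, 0 < c ∧ ∀ x : ℝ, 1 ≤ x →
    c * (x * Real.log x ^ n) ≤ ((tuples (n + 1) x).card : ℝ) := by
  induction n with
  | zero =>
    refine ⟨1 / 2, by norm_num, fun x hx => ?_⟩
    rw [card_tuples_one, pow_zero, mul_one]
    have h1 : (1 : ℝ) ≤ ⌊x⌋₊ := by
      exact_mod_cast (Nat.le_floor (by simpa using hx) : 1 ≤ ⌊x⌋₊)
    have h2 := Nat.lt_floor_add_one x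
    linarith
  | succ n ih =>
    obtain ⟨c, hc, ih⟩ := ih
    refine ⟨c / 2 ^ (n + 1), by positivity, fun x hx => ?_⟩
    have hlog : 0 ≤ Real.log x := Real.log_nonneg hx
    have hsq : Real.sqrt x ≤ x := by
      rw [Real.sqrt_le_left (by linarith)]; nlinarith
    have hlogsq : Real.log (Real.sqrt x) = Real.log x / 2 := Real.log_sqrt (by linarith)
    rw [card_tuples_succ]
    push_cast
    calc c / 2 ^ (n + 1) * (x * Real.log x ^ (n + 1))
        = c * x * (Real.log x / 2) ^ n * (Real.log x / 2) := by
          rw [div_pow, pow_succ, pow_succ]; field_simp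
      _ ≤ c * x * (Real.log x / 2) ^ n * (harmonic ⌊Real.sqrt x⌋₊ : ℚ) := by
          gcongr
          rw [← hlogsq]
          exact log_le_harmonic_floor _ (Real.sqrt_nonneg x)
      _ = ∑ a ∈ Finset.Icc 1 ⌊Real.sqrt x⌋₊, c * x * (Real.log x / 2) ^ n * (1 / a) := by
          rw [← Finset.mul_sum, sum_one_div_eq_harmonic]
      _ ≤ ∑ a ∈ Finset.Icc 1 ⌊Real.sqrt x⌋₊, ((tuples (n + 1) (x / a)).card : ℝ) := by
          refine Finset.sum_le_sum fun a ha => ?_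
          rw [Finset.mem_Icc] at ha
          have ha1 : (1 : ℝ) ≤ a := by exact_mod_cast ha.1
          have hax : (a : ℝ) ≤ Real.sqrt x := (Nat.le_floor_iff' (by omega)).1 ha.2
          have hxa : Real.sqrt x ≤ x / a := by
            rw [le_div_iff₀ (by linarith)]
            calc Real.sqrt x * a ≤ Real.sqrt x * Real.sqrt x := by gcongr
              _ = x := Real.mul_self_sqrt (by linarith)
          have h1 : 1 ≤ x / a := (ha1.trans hax).trans hxa
          refine le_trans ?_ (ih _ h1)
          have h2 : Real.log x / 2 ≤ Real.log (x / a) := by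
            rw [← hlogsq]; exact Real.log_le_log (by linarith) hxa
          calc c * x * (Real.log x / 2) ^ n * (1 / a) = c * (x / a * (Real.log x / 2) ^ n) := by ring
            _ ≤ _ := by gcongr
      _ ≤ _ := by
          refine Finset.sum_le_sum_of_subset_of_nonneg ?_ fun _ _ _ => Nat.cast_nonneg _
          exact Finset.Icc_subset_Icc le_rfl (Nat.floor_le_floor hsq)

/-- The tuples whose entries are coprime along all the pairs in `P`. -/
noncomputable def coprimeTuples {D : ℕ} (P : Finset (Fin D × Fin D)) (x : ℝ) :
    Finset (Fin D → ℕ) :=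
  (tuples D x).filter fun m => ∀ e ∈ P, (m e.1).Coprime (m e.2)

lemma mem_coprimeTuples {D : ℕ} {P : Finset (Fin D × Fin D)} {x : ℝ} {m : Fin D → ℕ} :
    m ∈ coprimeTuples P x ↔ m ∈ tuples D x ∧ ∀ e ∈ P, (m e.1).Coprime (m e.2) :=
  Finset.mem_filter

/-- Dividing the entries `i` and `j` by their greatest common divisor makes them coprime. -/
lemma card_coprimeTuples_le_sum {D : ℕ} (P : Finset (Fin D × Fin D)) {i j : Fin D} (hij : i ≠ j)
    (x : ℝ) : (coprimeTuples P x).card ≤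
      ∑ g ∈ Finset.Icc 1 ⌊x⌋₊, (coprimeTuples (insert (i, j) P) (x / (g : ℝ) ^ 2)).card := by
  rw [Finset.card_eq_sum_card_fiberwise (f := fun m => (m i).gcd (m j))
    (t := Finset.Icc 1 ⌊x⌋₊)]
  · refine Finset.sum_le_sum fun g hg => ?_
    have hg1 : 0 < g := (Finset.mem_Icc.1 hg).1
    let h : Fin D → ℕ := fun l => (if l = i then g else 1) * (if l = j then g else 1)
    have hhi : h i = g := by simp [h, hij]
    have hhj : h j = g := by simp [h, hij.symm]
    have hh : ∀ l, l ≠ i → l ≠ j → h l = 1 := fun l h1 h2 => by simp [h, h1, h2]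
    have hprod : ∏ l, h l = g ^ 2 := by
      simp only [h]
      rw [Finset.prod_mul_distrib, Finset.prod_ite_eq', Finset.prod_ite_eq',
        if_pos (Finset.mem_univ _), if_pos (Finset.mem_univ _), sq]
    have hdvd : ∀ m : Fin D → ℕ, (m i).gcd (m j) = g → ∀ l, h l ∣ m l := by
      intro m hm l
      rcases eq_or_ne l i with rfl | h1
      · rw [hhi, ← hm]; exact Nat.gcd_dvd_left _ _
      rcases eq_or_ne l j with rfl | h2
      · rw [hhj, ← hm]; exact Nat.gcd_dvd_right _ _
      rw [hh l h1 h2]; exact one_dvd _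
    refine Finset.card_le_card_of_injOn (fun m l => m l / h l) ?_ ?_
    · intro m hm
      simp only [Finset.coe_filter, Set.mem_ofPred_eq, mem_coprimeTuples, mem_tuples] at hm
      obtain ⟨⟨⟨hpos, hle⟩, hcop⟩, hgcd⟩ := hm
      have hd := hdvd m hgcd
      rw [Finset.mem_coe, mem_coprimeTuples, mem_tuples]
      refine ⟨⟨fun l => Nat.div_pos (Nat.le_of_dvd (hpos l) (hd l))
        (Nat.pos_of_dvd_of_pos (hd l) (hpos l)), ?_⟩, ?_⟩
      · rw [le_div_iff₀ (by positivity)]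
        refine le_trans (le_of_eq ?_) hle
        rw [← Nat.cast_pow, ← hprod, ← Nat.cast_mul, ← Finset.prod_mul_distrib]
        congr 1
        exact Finset.prod_congr rfl fun l _ => Nat.div_mul_cancel (hd l)
      · intro e he
        rcases Finset.mem_insert.1 he with rfl | he
        · simp only [hhi, hhj]
          rw [← hgcd]
          exact Nat.coprime_div_gcd_div_gcd (by rw [hgcd]; exact hg1)
        · exact Nat.Coprime.of_dvd (Nat.div_dvd_of_dvd (hd _)) (Nat.div_dvd_of_dvd (hd _))
            (hcop e he)
    · intro m hm m' hm' heq
      simp only [Finset.coe_filter, Set.mem_ofPred_eq] at hm hm'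
      funext l
      rw [← Nat.div_mul_cancel (hdvd m hm.2 l), ← Nat.div_mul_cancel (hdvd m' hm'.2 l)]
      exact congrArg (· * h l) (congrFun heq l)
  · intro m hm
    rw [Finset.mem_coe, mem_coprimeTuples] at hm
    have h1 := hm.1
    rw [tuples, Finset.mem_filter, Fintype.mem_piFinset] at h1
    have hi := Finset.mem_Icc.1 (h1.1 i)
    rw [Finset.mem_coe, Finset.mem_Icc]
    exact ⟨Nat.gcd_pos_of_pos_left _ hi.1, (Nat.gcd_le_left _ hi.1).trans hi.2⟩

lemma exists_le_card_coprimeTuples {n : ℕ} (P : Finset (Fin (n + 1) × Fin (n + 1)))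
    (hP : ∀ e ∈ P, e.1 ≠ e.2) : ∃ c : ℝ, 0 < c ∧ ∀ᶠ x : ℝ in Filter.atTop,
      c * (x * Real.log x ^ n) ≤ ((coprimeTuples P x).card : ℝ) := by
  induction P using Finset.induction_on with
  | empty =>
    obtain ⟨c, hc, h⟩ := exists_le_card_tuples n
    refine ⟨c, hc, ?_⟩
    filter_upwards [Filter.eventually_ge_atTop 1] with x hx
    simpa [coprimeTuples] using h x hx
  | insert e P _ ih =>
    obtain ⟨c, hc, ih⟩ := ih fun e' he' => hP e' (Finset.mem_insert_of_mem he')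
    have hij : e.1 ≠ e.2 := hP e (Finset.mem_insert_self _ _)
    obtain ⟨Y, hY⟩ := exists_nat_gt (2 * 2 ^ n / c)
    have hY0 : (0 : ℝ) < Y := lt_trans (by positivity) hY
    refine ⟨c / (2 * Y), by positivity, ?_⟩
    filter_upwards [ih, Filter.eventually_ge_atTop (Real.exp 1),
      Filter.eventually_ge_atTop 1] with x hx hxe hx1
    have hlog : 1 ≤ Real.log x := by
      rw [Real.le_log_iff_exp_le (by linarith)]; exact hxe
    set T := ((coprimeTuples (insert e P) x).card : ℝ) with hT
    have hterm : ∀ g ∈ Finset.Icc 1 ⌊x⌋₊,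
        ((coprimeTuples (insert e P) (x / (g : ℝ) ^ 2)).card : ℝ) ≤
          (if g ≤ Y then T else 0) +
            (if Y < g then x * (2 * Real.log x) ^ n * ((g : ℝ) ^ 2)⁻¹ else 0) := by
      intro g hg
      have hg1 : (1 : ℝ) ≤ g := by exact_mod_cast (Finset.mem_Icc.1 hg).1
      have hgx : x / (g : ℝ) ^ 2 ≤ x := div_le_self (by linarith) (one_le_pow₀ hg1)
      by_cases hgY : g ≤ Y
      · rw [if_pos hgY, if_neg (not_lt.2 hgY), add_zero, hT, Nat.cast_le]
        refine Finset.card_le_card fun m hm => ?_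
        rw [mem_coprimeTuples] at hm ⊢
        exact ⟨tuples_mono _ hgx hm.1, hm.2⟩
      · rw [if_neg hgY, if_pos (not_le.1 hgY), zero_add]
        have h1 : ((coprimeTuples (insert e P) (x / (g : ℝ) ^ 2)).card : ℝ) ≤
            (tuples (n + 1) (x / (g : ℝ) ^ 2)).card :=
          Nat.cast_le.2 (Finset.card_filter_le _ _)
        refine h1.trans ?_
        rcases lt_or_ge (x / (g : ℝ) ^ 2) 1 with hlt | hge
        · rw [tuples_eq_empty _ hlt, Finset.card_empty, Nat.cast_zero]
          positivity
        · have h2 : Real.log (x / (g : ℝ) ^ 2) ≤ Real.log x := Real.log_le_log (by linarith) hgx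
          have h3 : 0 ≤ Real.log (x / (g : ℝ) ^ 2) := Real.log_nonneg hge
          calc _ ≤ x / (g : ℝ) ^ 2 * (1 + Real.log (x / (g : ℝ) ^ 2)) ^ n := card_tuples_le n _ hge
            _ ≤ x / (g : ℝ) ^ 2 * (2 * Real.log x) ^ n := by
              gcongr
              linarith
            _ = _ := by ring
    have hsum1 : ∑ g ∈ Finset.Icc 1 ⌊x⌋₊, (if g ≤ Y then T else 0) ≤ Y * T := by
      rw [← Finset.sum_filter, Finset.sum_const, nsmul_eq_mul]
      refine mul_le_mul_of_nonneg_right ?_ (Nat.cast_nonneg _)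
      rw [Nat.cast_le]
      refine (Finset.card_le_card (t := Finset.Icc 1 Y) ?_).trans (by simp)
      intro g hg
      rw [Finset.mem_filter, Finset.mem_Icc] at hg
      exact Finset.mem_Icc.2 ⟨hg.1.1, hg.2⟩
    have hsum2 : ∑ g ∈ Finset.Icc 1 ⌊x⌋₊,
        (if Y < g then x * (2 * Real.log x) ^ n * ((g : ℝ) ^ 2)⁻¹ else 0) ≤
          x * (2 * Real.log x) ^ n * (Y : ℝ)⁻¹ := by
      rw [← Finset.sum_filter, ← Finset.mul_sum]
      refine mul_le_mul_of_nonneg_left ?_ (by positivity)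
      have hYn : Y ≠ 0 := by rintro rfl; simp at hY0
      calc ∑ g ∈ (Finset.Icc 1 ⌊x⌋₊).filter (Y < ·), ((g : ℝ) ^ 2)⁻¹
          ≤ ∑ g ∈ Finset.Ioc Y (max Y ⌊x⌋₊), ((g : ℝ) ^ 2)⁻¹ := by
            refine Finset.sum_le_sum_of_subset_of_nonneg ?_ fun _ _ _ => by positivity
            intro g hg
            rw [Finset.mem_filter, Finset.mem_Icc] at hg
            exact Finset.mem_Ioc.2 ⟨hg.2, hg.1.2.trans (le_max_right _ _)⟩
        _ ≤ (Y : ℝ)⁻¹ - ((max Y ⌊x⌋₊ : ℕ) : ℝ)⁻¹ := sum_Ioc_inv_sq_le_sub hYn (le_max_left _ _)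
        _ ≤ (Y : ℝ)⁻¹ := by
            have : (0 : ℝ) ≤ ((max Y ⌊x⌋₊ : ℕ) : ℝ)⁻¹ := by positivity
            linarith
    have hmain : c * (x * Real.log x ^ n) ≤ Y * T + x * (2 * Real.log x) ^ n * (Y : ℝ)⁻¹ := by
      calc _ ≤ _ := hx
        _ ≤ ((∑ g ∈ Finset.Icc 1 ⌊x⌋₊,
            (coprimeTuples (insert e P) (x / (g : ℝ) ^ 2)).card : ℕ) : ℝ) :=
            Nat.cast_le.2 (card_coprimeTuples_le_sum P hij x)
        _ ≤ _ := by
            push_cast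
            refine (Finset.sum_le_sum hterm).trans ?_
            rw [Finset.sum_add_distrib]
            exact add_le_add hsum1 hsum2
    have htail : x * (2 * Real.log x) ^ n * (Y : ℝ)⁻¹ ≤ c / 2 * (x * Real.log x ^ n) := by
      rw [div_lt_iff₀ hc] at hY
      rw [mul_pow, ← div_eq_mul_inv, div_le_iff₀ hY0]
      have : 0 ≤ x * Real.log x ^ n := by positivity
      nlinarith
    rw [div_mul_eq_mul_div, div_le_iff₀ (by positivity)]
    nlinarith

/-- The index set of pairs `i < j`. -/
abbrev IncPair (d : ℕ) := {e : Fin d × Fin d // e.1 < e.2}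

lemma card_incPair (d : ℕ) : Fintype.card (IncPair d) = d.choose 2 := by
  rw [Fintype.card_subtype, Finset.card_filter, ← Finset.univ_product_univ,
    Finset.sum_product_right]
  have h : ∀ j : Fin d, (∑ i : Fin d, if i < j then 1 else 0) = (j : ℕ) := by
    intro j
    rw [← Finset.card_filter, Finset.filter_gt_eq_Iio, Fin.card_Iio]
  simp only [h]
  rw [Fin.sum_univ_eq_sum_range (fun i => i), Finset.sum_range_id, Nat.choose_two_right]

/-- The ring of vectors satisfying the congruences `x i ≡ x j` modulo `m (i, j)`. -/
def congruenceOrder {d : ℕ} (m : IncPair d → ℕ) : Subring (Fin d → ℤ) where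
  carrier := {x | ∀ e : IncPair d, (m e : ℤ) ∣ x e.1.1 - x e.1.2}
  mul_mem' {x y} hx hy e := by
    obtain ⟨a, ha⟩ := hx e
    obtain ⟨b, hb⟩ := hy e
    refine ⟨y e.1.1 * a + x e.1.2 * b, ?_⟩
    rw [Pi.mul_apply, Pi.mul_apply]
    linear_combination y e.1.1 * ha + x e.1.2 * hb
  one_mem' e := by simp
  add_mem' {x y} hx hy e := by
    obtain ⟨a, ha⟩ := hx e
    obtain ⟨b, hb⟩ := hy e
    refine ⟨a + b, ?_⟩
    rw [Pi.add_apply, Pi.add_apply]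
    linear_combination ha + hb
  zero_mem' e := by simp
  neg_mem' {x} hx e := by
    obtain ⟨a, ha⟩ := hx e
    refine ⟨-a, ?_⟩
    rw [Pi.neg_apply, Pi.neg_apply]
    linear_combination -ha

lemma index_congruenceOrder {d : ℕ} {m : IncPair d → ℕ} (hm : ∀ e, 1 ≤ m e) :
    (congruenceOrder m).toAddSubgroup.index ≠ 0 ∧
      (congruenceOrder m).toAddSubgroup.index ≤ ∏ e, m e := by
  let f : IncPair d → ((Fin d → ℤ) →+ ℤ) := fun e =>
    Pi.evalAddMonoidHom (fun _ : Fin d => ℤ) e.1.1 - Pi.evalAddMonoidHom (fun _ : Fin d => ℤ) e.1.2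
  have hf : ∀ e, Function.Surjective (f e) := by
    intro e z
    refine ⟨Pi.single e.1.1 z, ?_⟩
    simp [f, e.2.ne']
  have hind : ∀ e, ((AddSubgroup.zmultiples (m e : ℤ)).comap (f e)).index = m e := by
    intro e
    rw [AddSubgroup.index_comap_of_surjective _ (hf e), Int.index_zmultiples, Int.natAbs_natCast]
  have heq : (congruenceOrder m).toAddSubgroup =
      ⨅ e, (AddSubgroup.zmultiples (m e : ℤ)).comap (f e) := by
    ext x
    rw [AddSubgroup.mem_iInf]
    refine forall_congr' fun e => ?_
    rw [AddSubgroup.mem_comap, Int.mem_zmultiples_iff]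
    rfl
  rw [heq]
  constructor
  · refine AddSubgroup.index_iInf_ne_zero fun e => ?_
    rw [hind]
    have := hm e
    omega
  · refine (AddSubgroup.index_iInf_le _).trans (le_of_eq ?_)
    exact Finset.prod_congr rfl fun e _ => hind e

/-- A vector satisfying all the congruences but one, and violating that one completely. -/
lemma exists_separating_vector {d : ℕ} {m : IncPair d → ℕ}
    (hcop : ∀ e f, e ≠ f → (m e).Coprime (m f)) (e : IncPair d) :
    ∃ w : Fin d → ℤ, w e.1.1 - w e.1.2 = 1 ∧
      ∀ f, f ≠ e → (m f : ℤ) ∣ w f.1.1 - w f.1.2 := by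
  classical
  obtain ⟨⟨i, j⟩, hij⟩ := e
  have hz : ∀ l : Fin d, ∃ z : ℤ, ∀ f : IncPair d,
      ((f.1 = (i, l) ∨ f.1 = (l, i)) → (m f : ℤ) ∣ z - 1) ∧
      (¬ (f.1 = (i, l) ∨ f.1 = (l, i)) → (m f : ℤ) ∣ z) := by
    intro l
    by_cases h : ∃ g : IncPair d, g.1 = (i, l) ∨ g.1 = (l, i)
    · obtain ⟨g, hg⟩ := h
      have huniq : ∀ f : IncPair d, (f.1 = (i, l) ∨ f.1 = (l, i)) → f = g := by
        rintro ⟨⟨a, b⟩, hab⟩ hf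
        obtain ⟨⟨a', b'⟩, hab'⟩ := g
        simp only [Prod.mk.injEq, Subtype.mk.injEq] at hf hg ⊢
        simp only at hab hab'
        omega
      have hc : IsCoprime (m g : ℤ) ((∏ f ∈ Finset.univ.erase g, m f : ℕ) : ℤ) := by
        rw [Nat.isCoprime_iff_coprime]
        exact Nat.Coprime.prod_right fun f hf => hcop g f (Finset.ne_of_mem_erase hf).symm
      obtain ⟨a, b, hab⟩ := hc
      refine ⟨b * ((∏ f ∈ Finset.univ.erase g, m f : ℕ) : ℤ), fun f => ⟨fun hf => ?_, fun hf => ?_⟩⟩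
      · rw [huniq f hf]
        exact ⟨-a, by linear_combination hab⟩
      · refine Dvd.dvd.mul_left ?_ b
        rw [Int.natCast_dvd_natCast]
        refine Finset.dvd_prod_of_mem m (Finset.mem_erase.2 ⟨?_, Finset.mem_univ f⟩)
        rintro rfl
        exact hf hg
    · exact ⟨0, fun f => ⟨fun hf => absurd ⟨f, hf⟩ h, fun _ => dvd_zero _⟩⟩
  choose z hz using hz
  refine ⟨fun l => if l = i then 1 else if l = j then 0 else z l, ?_, ?_⟩
  · simp [hij.ne']
  · rintro ⟨⟨a, b⟩, hab⟩ hne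
    simp only at hab ⊢
    have hij' : i < j := hij
    set f : IncPair d := ⟨(a, b), hab⟩ with hf
    have hne' : ¬ (a = i ∧ b = j) := fun h => hne (by simp [hf, h])
    rcases eq_or_ne a i with rfl | hai
    · have hbj : b ≠ j := fun h => hne' ⟨rfl, h⟩
      rw [if_pos rfl, if_neg hab.ne', if_neg hbj, ← dvd_neg, neg_sub]
      exact (hz b f).1 (Or.inl rfl)
    rcases eq_or_ne b i with rfl | hbi
    · rw [if_neg hab.ne, if_neg (hab.trans hij').ne, if_pos rfl]
      exact (hz a f).1 (Or.inr rfl)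
    have hz' : ∀ l, (m f : ℤ) ∣ if l = j then 0 else z l := by
      intro l
      split_ifs
      · exact dvd_zero _
      · refine (hz l f).2 ?_
        simp [hf, hai, hbi]
    rw [if_neg hai, if_neg hbi]
    exact dvd_sub (hz' a) (hz' b)

lemma congruenceOrder_injOn {d : ℕ} {m m' : IncPair d → ℕ}
    (hm : ∀ e f, e ≠ f → (m e).Coprime (m f)) (hm' : ∀ e f, e ≠ f → (m' e).Coprime (m' f))
    (h : congruenceOrder m = congruenceOrder m') : m = m' := by
  have key : ∀ n n' : IncPair d → ℕ, (∀ e f, e ≠ f → (n e).Coprime (n f)) →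
      congruenceOrder n = congruenceOrder n' → ∀ e, n' e ∣ n e := by
    intro n n' hn hnn e
    obtain ⟨w, hw1, hw⟩ := exists_separating_vector hn e
    have hmem : (n e : ℤ) • w ∈ congruenceOrder n := by
      intro f
      simp only [Pi.smul_apply, smul_eq_mul, ← mul_sub]
      rcases eq_or_ne f e with rfl | hf
      · exact dvd_mul_right _ _
      · exact (hw f hf).mul_left _
    rw [hnn] at hmem
    have := hmem e
    simp only [Pi.smul_apply, smul_eq_mul, ← mul_sub, hw1, mul_one] at this
    exact_mod_cast this
  funext e
  exact Nat.dvd_antisymm (key m' m hm' h.symm e) (key m m' hm h e)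

lemma card_coprimeTuples_le_numOrdersZ {d D : ℕ} (hd : 6 ≤ d) (σ : Fin D ≃ IncPair d) {B : ℝ}
    (hB : 0 < B) : (coprimeTuples Finset.univ.offDiag B : Finset (Fin D → ℕ)).card ≤
      numOrdersZ d B := by
  have hfin : Finite {O : OrderZ d // (O.1.toAddSubgroup.index : ℝ) ≤ B} := by
    obtain ⟨k, rfl⟩ : ∃ k, d = k + 5 := ⟨d - 5, by omega⟩
    refine (finite_orders_and_card_le (s := ((k + 5 : ℕ) : ℝ) / 2) (by positivity)
      (orderZeta_lt_top k _ (by linarith)) hB).1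
  have hcop : ∀ m ∈ (coprimeTuples Finset.univ.offDiag B : Finset (Fin D → ℕ)),
      ∀ e f, e ≠ f → (m (σ.symm e)).Coprime (m (σ.symm f)) := fun m hm e f hef =>
    (mem_coprimeTuples.1 hm).2 (σ.symm e, σ.symm f)
      (Finset.mem_offDiag.2 ⟨Finset.mem_univ _, Finset.mem_univ _, σ.symm.injective.ne hef⟩)
  have hind : ∀ m ∈ (coprimeTuples Finset.univ.offDiag B : Finset (Fin D → ℕ)),
      (congruenceOrder (m ∘ σ.symm)).toAddSubgroup.index ≠ 0 ∧
        ((congruenceOrder (m ∘ σ.symm)).toAddSubgroup.index : ℝ) ≤ B := by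
    intro m hm
    have hm' := mem_tuples.1 (mem_coprimeTuples.1 hm).1
    obtain ⟨h1, h2⟩ := index_congruenceOrder (m := m ∘ σ.symm) fun e => hm'.1 _
    refine ⟨h1, le_trans (Nat.cast_le.2 (h2.trans_eq ?_)) hm'.2⟩
    exact Equiv.prod_comp σ.symm m
  rw [numOrdersZ_eq, ← Fintype.card_coe, ← Nat.card_eq_fintype_card]
  refine Nat.card_le_card_of_injective
    (fun m => ⟨⟨congruenceOrder (m.1 ∘ σ.symm), (hind m.1 m.2).1⟩, (hind m.1 m.2).2⟩) ?_
  intro m m' h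
  have h' : congruenceOrder (m.1 ∘ σ.symm) = congruenceOrder (m'.1 ∘ σ.symm) :=
    congrArg (fun O => O.1.1) h
  exact Subtype.ext (σ.symm.surjective.injective_comp_right
    (congruenceOrder_injOn (hcop m.1 m.2) (hcop m'.1 m'.2) h'))

lemma exists_le_numOrdersZ (d : ℕ) (hd : 6 ≤ d) : ∃ c : ℝ, 0 < c ∧ ∀ᶠ B : ℝ in Filter.atTop,
    c * (B * Real.log B ^ ((d.choose 2 : ℝ) - 1)) ≤ (numOrdersZ d B : ℝ) := by
  obtain ⟨n, hn⟩ : ∃ n, d.choose 2 = n + 1 :=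
    Nat.exists_eq_succ_of_ne_zero (Nat.choose_pos (by omega)).ne'
  let σ : Fin (n + 1) ≃ IncPair d := (Fintype.equivFinOfCardEq ((card_incPair d).trans hn)).symm
  obtain ⟨c, hc, h⟩ := exists_le_card_coprimeTuples (n := n) Finset.univ.offDiag
    fun e he => (Finset.mem_offDiag.1 he).2.2
  refine ⟨c, hc, ?_⟩
  filter_upwards [h, Filter.eventually_gt_atTop 0] with B hB hB0
  rw [hn, Nat.cast_succ, add_sub_cancel_right, Real.rpow_natCast]
  exact hB.trans (Nat.cast_le.2 (card_coprimeTuples_le_numOrdersZ hd σ hB0))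

/-- For `d ≥ 6`: `B (log B)^(C(d,2)-1) ≪ N_d(B)` and, for every `ε > 0`,
`N_d(B) ≪_ε B^(d/2 - 7/6 + ε)` as `B → ∞`. -/
theorem stmt7 (d : ℕ) (hd : 6 ≤ d) :
    (∃ c : ℝ, 0 < c ∧ ∀ᶠ B : ℝ in Filter.atTop,
        c * (B * Real.log B ^ ((d.choose 2 : ℝ) - 1)) ≤ (numOrdersZ d B : ℝ)) ∧
      ∀ ε : ℝ, 0 < ε → ∃ C : ℝ, 0 < C ∧ ∀ᶠ B : ℝ in Filter.atTop,
        (numOrdersZ d B : ℝ) ≤ C * B ^ ((d : ℝ) / 2 - 7 / 6 + ε) :=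
  ⟨exists_le_numOrdersZ d hd, fun _ hε => exists_numOrdersZ_le d hd hε⟩
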